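/- arXiv:2102.04461 — 2 statements merged into one kernel-verified Lean document; each statement's English description precedes it below -/
import Mathlib

section
/- The covariance set F(P,Q) is a compact subset of the space of real I×J matrices. -/
open MeasureTheory Matrix

/-- The set of couplings of `P` and `Q`: probability measures on the product
whose first marginal is `P` and whose second marginal is `Q`. -/
def couplings {I J : ℕ} (P : Measure (Fin I → ℝ)) (Q : Measure (Fin J → ℝ)) :
    Set (Measure ((Fin I → ℝ) × (Fin J → ℝ))) :=
  {π | IsProbabilityMeasure π ∧ π.map Prod.fst = P ∧ π.map Prod.snd = Q}

/-- The cross-covariance matrix of a coupling. -/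
noncomputable def crossCov {I J : ℕ} (π : Measure ((Fin I → ℝ) × (Fin J → ℝ))) :
    Matrix (Fin I) (Fin J) ℝ :=
  Matrix.of fun i j => ∫ p, p.1 i * p.2 j ∂π

/-- The covariance set `F(P,Q)`. -/
noncomputable def covSet {I J : ℕ} (P : Measure (Fin I → ℝ)) (Q : Measure (Fin J → ℝ)) :
    Set (Matrix (Fin I) (Fin J) ℝ) :=
  crossCov '' couplings P Q

section Helpers

open Filter Topology

/-- The set of couplings, as a set of probability measures. -/
def couplingsPM {I J : ℕ} (P : Measure (Fin I → ℝ)) (Q : Measure (Fin J → ℝ)) :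
    Set (ProbabilityMeasure ((Fin I → ℝ) × (Fin J → ℝ))) :=
  {π | (π : Measure ((Fin I → ℝ) × (Fin J → ℝ))) ∈ couplings P Q}

lemma couplingsPM_isClosed {I J : ℕ} (P : Measure (Fin I → ℝ)) (Q : Measure (Fin J → ℝ))
    [hP : IsProbabilityMeasure P] [hQ : IsProbabilityMeasure Q] :
    IsClosed (couplingsPM P Q) := by
  have h1 := ProbabilityMeasure.continuous_map
    (continuous_fst (X := Fin I → ℝ) (Y := Fin J → ℝ))
  have h2 := ProbabilityMeasure.continuous_map
    (continuous_snd (X := Fin I → ℝ) (Y := Fin J → ℝ))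
  let P' : ProbabilityMeasure (Fin I → ℝ) := ⟨P, hP⟩
  let Q' : ProbabilityMeasure (Fin J → ℝ) := ⟨Q, hQ⟩
  have := (isClosed_eq h1 (continuous_const (y := P'))).inter
    (isClosed_eq h2 (continuous_const (y := Q')))
  convert! this using 1
  ext π
  constructor
  · rintro ⟨-, a, b⟩
    exact ⟨Subtype.ext a, Subtype.ext b⟩
  · rintro ⟨a, b⟩
    exact ⟨π.2, congrArg Subtype.val a, congrArg Subtype.val b⟩

lemma couplingsPM_isCompact {I J : ℕ} (P : Measure (Fin I → ℝ)) (Q : Measure (Fin J → ℝ))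
    [hP : IsProbabilityMeasure P] [hQ : IsProbabilityMeasure Q] :
    IsCompact (couplingsPM P Q) := by
  rw [← (couplingsPM_isClosed P Q).closure_eq]
  apply isCompact_closure_of_isTightMeasureSet
  rw [isTightMeasureSet_iff_exists_isCompact_measure_compl_le]
  intro ε hε
  have tP : IsTightMeasureSet {P} := isTightMeasureSet_singleton
  have tQ : IsTightMeasureSet {Q} := isTightMeasureSet_singleton
  rw [isTightMeasureSet_iff_exists_isCompact_measure_compl_le] at tP tQ
  obtain ⟨K, hK, hK'⟩ := tP (ε / 2) (ENNReal.half_pos hε.ne')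
  obtain ⟨L, hL, hL'⟩ := tQ (ε / 2) (ENNReal.half_pos hε.ne')
  refine ⟨K ×ˢ L, hK.prod hL, ?_⟩
  rintro _ ⟨π, ⟨-, h1, h2⟩, rfl⟩
  have e1 : (π : Measure ((Fin I → ℝ) × (Fin J → ℝ))) (Prod.fst ⁻¹' Kᶜ) ≤ ε / 2 := by
    rw [← Measure.map_apply measurable_fst hK.measurableSet.compl, h1]
    exact hK' P rfl
  have e2 : (π : Measure ((Fin I → ℝ) × (Fin J → ℝ))) (Prod.snd ⁻¹' Lᶜ) ≤ ε / 2 := by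
    rw [← Measure.map_apply measurable_snd hL.measurableSet.compl, h2]
    exact hL' Q rfl
  have hsub : (K ×ˢ L)ᶜ ⊆ (Prod.fst ⁻¹' Kᶜ) ∪ (Prod.snd ⁻¹' Lᶜ) := by
    rintro ⟨x, y⟩ h
    by_cases hx : x ∈ K
    · right
      exact fun hy => h ⟨hx, hy⟩
    · left
      exact hx
  calc _ ≤ _ := measure_mono hsub
    _ ≤ _ := measure_union_le _ _
    _ ≤ ε / 2 + ε / 2 := add_le_add e1 e2
    _ = ε := ENNReal.add_halves ε

lemma tail_integrable {I : ℕ} (P : Measure (Fin I → ℝ)) [IsProbabilityMeasure P]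
    (hP : Integrable (fun x => ‖x‖ ^ 2) P) (n : ℕ) :
    Integrable (fun x => max (‖x‖ ^ 2 - n) 0) P :=
  (hP.sub (integrable_const _)).sup (integrable_const 0)

lemma tail_tendsto {I : ℕ} (P : Measure (Fin I → ℝ)) [IsProbabilityMeasure P]
    (hP : Integrable (fun x => ‖x‖ ^ 2) P) :
    Tendsto (fun n : ℕ => ∫ x, max (‖x‖ ^ 2 - n) 0 ∂P) atTop (𝓝 0) := by
  have := tendsto_integral_of_dominated_convergence (μ := P)
    (F := fun (n : ℕ) (x : Fin I → ℝ) => max (‖x‖ ^ 2 - n) 0) (f := fun _ => 0)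
    (fun x => ‖x‖ ^ 2) (fun n => (tail_integrable P hP n).aestronglyMeasurable) hP
    (fun n => Eventually.of_forall fun x => by
      rw [Real.norm_eq_abs, abs_of_nonneg (le_max_right _ _)]
      exact max_le (by have : (0 : ℝ) ≤ n := n.cast_nonneg
                       linarith) (by positivity))
    (Eventually.of_forall fun x => by
      apply tendsto_const_nhds.congr'
      obtain ⟨N, hN⟩ := exists_nat_ge (‖x‖ ^ 2)
      filter_upwards [eventually_ge_atTop N] with n hn
      have : (N : ℝ) ≤ n := by exact_mod_cast hn
      exact (max_eq_right (by linarith)).symm)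
  simpa using this

lemma trunc_bound {a x y n : ℝ} (hx : 0 ≤ x) (hy : 0 ≤ y) (ha : |a| ≤ x * y) (hn : 0 ≤ n) :
    |a - max (-n) (min a n)| ≤ max (x ^ 2 - n) 0 + max (y ^ 2 - n) 0 := by
  have h1 := le_max_left (x ^ 2 - n) 0
  have h2 := le_max_right (x ^ 2 - n) 0
  have h3 := le_max_left (y ^ 2 - n) 0
  have h4 := le_max_right (y ^ 2 - n) 0
  have h5 : |a| - n ≤ max (x ^ 2 - n) 0 + max (y ^ 2 - n) 0 := by
    rcases le_total x y with h | h <;> nlinarith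
  obtain ⟨h6, h7⟩ := abs_le.1 (le_refl |a|)
  rcases le_total a n with h | h
  · rw [min_eq_left h]
    rcases le_total (-n) a with h' | h'
    · rw [max_eq_right h']
      simp only [sub_self, abs_zero]
      linarith
    · rw [max_eq_left h', abs_le]
      constructor <;> linarith
  · rw [min_eq_right h, max_eq_right (by linarith), abs_le]
    constructor <;> linarith

lemma coord_bound {I J : ℕ} (i : Fin I) (j : Fin J) (p : (Fin I → ℝ) × (Fin J → ℝ)) :
    |p.1 i * p.2 j| ≤ ‖p.1‖ * ‖p.2‖ := by
  rw [abs_mul]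
  exact mul_le_mul (norm_le_pi_norm p.1 i) (norm_le_pi_norm p.2 j) (abs_nonneg _) (norm_nonneg _)

/-- Truncation of the product of two coordinates. -/
noncomputable def truncProd {I J : ℕ} (i : Fin I) (j : Fin J) (n : ℕ) :
    BoundedContinuousFunction ((Fin I → ℝ) × (Fin J → ℝ)) ℝ :=
  BoundedContinuousFunction.ofNormedAddCommGroup
    (fun p => max (-(n : ℝ)) (min (p.1 i * p.2 j) n)) (by fun_prop) n (by
      intro p
      have : (0 : ℝ) ≤ n := n.cast_nonneg
      rw [Real.norm_eq_abs, abs_le]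
      exact ⟨le_max_left _ _, max_le (by linarith) (min_le_right _ _)⟩)

lemma integral_trunc_bound {I J : ℕ} (P : Measure (Fin I → ℝ)) (Q : Measure (Fin J → ℝ))
    [IsProbabilityMeasure P] [IsProbabilityMeasure Q]
    (hP : Integrable (fun x => ‖x‖ ^ 2) P) (hQ : Integrable (fun y => ‖y‖ ^ 2) Q)
    (i : Fin I) (j : Fin J) (n : ℕ) (π : Measure ((Fin I → ℝ) × (Fin J → ℝ)))
    (hπ : π ∈ couplings P Q) :
    |(∫ p, p.1 i * p.2 j ∂π) - ∫ p, truncProd i j n p ∂π| ≤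
      (∫ x, max (‖x‖ ^ 2 - n) 0 ∂P) + ∫ y, max (‖y‖ ^ 2 - n) 0 ∂Q := by
  obtain ⟨hpr, h1, h2⟩ := hπ
  have m1 : MeasurePreserving Prod.fst π P := ⟨measurable_fst, h1⟩
  have m2 : MeasurePreserving Prod.snd π Q := ⟨measurable_snd, h2⟩
  have i1 := m1.integrable_comp_of_integrable hP
  have i2 := m2.integrable_comp_of_integrable hQ
  have t1 : Integrable (fun p : (Fin I → ℝ) × (Fin J → ℝ) => max (‖p.1‖ ^ 2 - (n : ℝ)) 0) π :=
    m1.integrable_comp_of_integrable (tail_integrable P hP n)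
  have t2 : Integrable (fun p : (Fin I → ℝ) × (Fin J → ℝ) => max (‖p.2‖ ^ 2 - (n : ℝ)) 0) π :=
    m2.integrable_comp_of_integrable (tail_integrable Q hQ n)
  have e1 : ∫ x, max (‖x‖ ^ 2 - n) 0 ∂P =
      ∫ p : (Fin I → ℝ) × (Fin J → ℝ), max (‖p.1‖ ^ 2 - n) 0 ∂π := by
    rw [← h1]
    exact integral_map measurable_fst.aemeasurable
      (by rw [h1]; exact (tail_integrable P hP n).aestronglyMeasurable)
  have e2 : ∫ x, max (‖x‖ ^ 2 - n) 0 ∂Q =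
      ∫ p : (Fin I → ℝ) × (Fin J → ℝ), max (‖p.2‖ ^ 2 - n) 0 ∂π := by
    rw [← h2]
    exact integral_map measurable_snd.aemeasurable
      (by rw [h2]; exact (tail_integrable Q hQ n).aestronglyMeasurable)
  have hf : Integrable (fun p : (Fin I → ℝ) × (Fin J → ℝ) => p.1 i * p.2 j) π := by
    refine (i1.add i2).mono' (Continuous.aestronglyMeasurable (by fun_prop))
      (Eventually.of_forall fun p => ?_)
    have := coord_bound i j p
    simp only [Pi.add_apply, Function.comp_apply, Real.norm_eq_abs]
    nlinarith [sq_nonneg (‖p.1‖ - ‖p.2‖), sq_nonneg ‖p.1‖, sq_nonneg ‖p.2‖]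
  rw [e1, e2, ← integral_add t1 t2, ← integral_sub hf ((truncProd i j n).integrable π),
    ← Real.norm_eq_abs]
  refine norm_integral_le_of_norm_le (t1.add t2) (Eventually.of_forall fun p => ?_)
  exact trunc_bound (norm_nonneg _) (norm_nonneg _) (coord_bound i j p) n.cast_nonneg

lemma continuousOn_entry {I J : ℕ} (P : Measure (Fin I → ℝ)) (Q : Measure (Fin J → ℝ))
    [IsProbabilityMeasure P] [IsProbabilityMeasure Q]
    (hP : Integrable (fun x => ‖x‖ ^ 2) P) (hQ : Integrable (fun y => ‖y‖ ^ 2) Q)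
    (i : Fin I) (j : Fin J) :
    ContinuousOn (fun π : ProbabilityMeasure ((Fin I → ℝ) × (Fin J → ℝ)) =>
      ∫ p, p.1 i * p.2 j ∂(π : Measure ((Fin I → ℝ) × (Fin J → ℝ)))) (couplingsPM P Q) := by
  have key : TendstoUniformlyOn
      (fun (n : ℕ) (π : ProbabilityMeasure ((Fin I → ℝ) × (Fin J → ℝ))) =>
        ∫ p, truncProd i j n p ∂(π : Measure ((Fin I → ℝ) × (Fin J → ℝ))))
      (fun π : ProbabilityMeasure ((Fin I → ℝ) × (Fin J → ℝ)) =>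
        ∫ p, p.1 i * p.2 j ∂(π : Measure ((Fin I → ℝ) × (Fin J → ℝ)))) atTop
      (couplingsPM P Q) := by
    rw [Metric.tendstoUniformlyOn_iff]
    intro ε hε
    have h := (tail_tendsto P hP).add (tail_tendsto Q hQ)
    rw [add_zero] at h
    filter_upwards [h.eventually_lt_const hε] with n hn π hπ
    rw [Real.dist_eq]
    exact (integral_trunc_bound P Q hP hQ i j n _ hπ).trans_lt hn
  exact key.continuousOn (Frequently.of_forall fun n =>
    (ProbabilityMeasure.continuous_integral_boundedContinuousFunction
      (truncProd i j n)).continuousOn)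

end Helpers

/-- the covariance set `F(P,Q)` is compact. -/
theorem covSet_compact {I J : ℕ} (hI : 0 < I) (hJ : 0 < J)
    (P : Measure (Fin I → ℝ)) (Q : Measure (Fin J → ℝ))
    [IsProbabilityMeasure P] [IsProbabilityMeasure Q]
    (hP : Integrable (fun x => ‖x‖ ^ 2) P) (hQ : Integrable (fun y => ‖y‖ ^ 2) Q) :
    IsCompact (covSet P Q) := by
  have hc : ContinuousOn (fun π : ProbabilityMeasure ((Fin I → ℝ) × (Fin J → ℝ)) =>
      crossCov (π : Measure ((Fin I → ℝ) × (Fin J → ℝ)))) (couplingsPM P Q) :=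
    continuousOn_pi.2 fun i => continuousOn_pi.2 fun j => continuousOn_entry P Q hP hQ i j
  have := (couplingsPM_isCompact P Q).image_of_continuousOn hc
  convert! this using 1
  ext M
  constructor
  · rintro ⟨π, hπ, rfl⟩
    exact ⟨⟨π, hπ.1⟩, hπ, rfl⟩
  · rintro ⟨π, hπ, rfl⟩
    exact ⟨π, hπ, rfl⟩
end

section
/- For a coupling π ∈ Π(P,Q) and a nonzero matrix M ∈ M_{I,J}(ℝ), the following are equivalent: (a) Tr(Mᵀ σ_π) = sup over all π̃ ∈ Π(P,Q) of Tr(Mᵀ σ_{π̃}); (b) there exists a proper lower semicontinuous convex function u : ℝ^I → ℝ ∪ {+∞} such that for π-almost every (x,y), My belongs to the subdifferential of u at x, i.e. u(z) ≥ u(x) + (My)·(z − x) for all z ∈ ℝ^I. -/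
open MeasureTheory Matrix

/-- Convexity for extended-real-valued functions on `ℝ^I`. -/
def ERealConvexOn {n : ℕ} (u : (Fin n → ℝ) → EReal) : Prop :=
  ∀ x y : Fin n → ℝ, ∀ a b : ℝ, 0 ≤ a → 0 ≤ b → a + b = 1 →
    u (a • x + b • y) ≤ (a : EReal) * u x + (b : EReal) * u y

open Filter Topology

noncomputable def cst {I J : ℕ} (M : Matrix (Fin I) (Fin J) ℝ) (p : (Fin I → ℝ) × (Fin J → ℝ)) : ℝ :=
  M.mulVec p.2 ⬝ᵥ p.1

lemma cst_cont {I J : ℕ} (M : Matrix (Fin I) (Fin J) ℝ) : Continuous (cst M) := by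
  unfold cst
  fun_prop

lemma cst_eq {I J : ℕ} (M : Matrix (Fin I) (Fin J) ℝ) (p : (Fin I → ℝ) × (Fin J → ℝ)) :
    cst M p = ∑ j, ∑ i, M i j * (p.1 i * p.2 j) := by
  unfold cst
  simp only [dotProduct, Matrix.mulVec, Finset.sum_mul]
  rw [Finset.sum_comm]
  refine Finset.sum_congr rfl fun j _ => Finset.sum_congr rfl fun i _ => by ring

lemma entry_bound {I J : ℕ} (p : (Fin I → ℝ) × (Fin J → ℝ)) (i : Fin I) (j : Fin J) :
    |p.1 i * p.2 j| ≤ ‖p.1‖ ^ 2 + ‖p.2‖ ^ 2 := by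
  have h1 : |p.1 i| ≤ ‖p.1‖ := norm_le_pi_norm p.1 i
  have h2 : |p.2 j| ≤ ‖p.2‖ := norm_le_pi_norm p.2 j
  rw [abs_mul]
  have := mul_le_mul h1 h2 (abs_nonneg _) (norm_nonneg _)
  nlinarith [sq_nonneg (‖p.1‖ - ‖p.2‖), sq_nonneg (‖p.1‖), sq_nonneg ‖p.2‖]

lemma bound_int {I J : ℕ} {P : Measure (Fin I → ℝ)} {Q : Measure (Fin J → ℝ)}
    (hP : Integrable (fun x => ‖x‖ ^ 2) P) (hQ : Integrable (fun y => ‖y‖ ^ 2) Q)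
    {π : Measure ((Fin I → ℝ) × (Fin J → ℝ))} (hπ : π ∈ couplings P Q) :
    Integrable (fun p => ‖p.1‖ ^ 2 + ‖p.2‖ ^ 2) π ∧
    ∫ p, (‖p.1‖ ^ 2 + ‖p.2‖ ^ 2) ∂π = (∫ x, ‖x‖ ^ 2 ∂P) + ∫ y, ‖y‖ ^ 2 ∂Q := by
  obtain ⟨h0, rfl, rfl⟩ := hπ
  have a1 : Integrable (fun p : (Fin I → ℝ) × (Fin J → ℝ) => ‖p.1‖ ^ 2) π :=
    hP.comp_measurable measurable_fst
  have a2 : Integrable (fun p : (Fin I → ℝ) × (Fin J → ℝ) => ‖p.2‖ ^ 2) π :=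
    hQ.comp_measurable measurable_snd
  refine ⟨a1.add a2, ?_⟩
  rw [integral_add a1 a2, integral_map measurable_fst.aemeasurable hP.1,
    integral_map measurable_snd.aemeasurable hQ.1]

lemma entry_int {I J : ℕ} {P : Measure (Fin I → ℝ)} {Q : Measure (Fin J → ℝ)}
    (hP : Integrable (fun x => ‖x‖ ^ 2) P) (hQ : Integrable (fun y => ‖y‖ ^ 2) Q)
    {π : Measure ((Fin I → ℝ) × (Fin J → ℝ))} (hπ : π ∈ couplings P Q) (i : Fin I) (j : Fin J) :
    Integrable (fun p => p.1 i * p.2 j) π := by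
  refine (bound_int hP hQ hπ).1.mono' ?_ (.of_forall fun p => entry_bound p i j)
  exact (by fun_prop : Continuous fun p : (Fin I → ℝ) × (Fin J → ℝ) => p.1 i * p.2 j).aestronglyMeasurable

lemma cst_int {I J : ℕ} {P : Measure (Fin I → ℝ)} {Q : Measure (Fin J → ℝ)}
    (hP : Integrable (fun x => ‖x‖ ^ 2) P) (hQ : Integrable (fun y => ‖y‖ ^ 2) Q)
    {π : Measure ((Fin I → ℝ) × (Fin J → ℝ))} (hπ : π ∈ couplings P Q)
    (M : Matrix (Fin I) (Fin J) ℝ) : Integrable (cst M) π := by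
  have : cst M = fun p => ∑ j, ∑ i, M i j * (p.1 i * p.2 j) := funext (cst_eq M)
  rw [this]
  exact integrable_finsetSum _ fun j _ => integrable_finsetSum _ fun i _ =>
    (entry_int hP hQ hπ i j).const_mul _

lemma trace_eq {I J : ℕ} {P : Measure (Fin I → ℝ)} {Q : Measure (Fin J → ℝ)}
    (hP : Integrable (fun x => ‖x‖ ^ 2) P) (hQ : Integrable (fun y => ‖y‖ ^ 2) Q)
    {π : Measure ((Fin I → ℝ) × (Fin J → ℝ))} (hπ : π ∈ couplings P Q)
    (M : Matrix (Fin I) (Fin J) ℝ) : (M.transpose * crossCov π).trace = ∫ p, cst M p ∂π := by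
  simp_rw [cst_eq]
  rw [integral_finsetSum _ fun j _ => integrable_finsetSum _ fun i _ =>
    (entry_int hP hQ hπ i j).const_mul _]
  simp only [Matrix.trace, Matrix.diag, Matrix.mul_apply, Matrix.transpose_apply, crossCov, Matrix.of_apply]
  refine Finset.sum_congr rfl fun j _ => ?_
  rw [integral_finsetSum _ fun i _ => (entry_int hP hQ hπ i j).const_mul _]
  refine Finset.sum_congr rfl fun i _ => ?_
  rw [integral_const_mul]

lemma bdd {I J : ℕ} {P : Measure (Fin I → ℝ)} {Q : Measure (Fin J → ℝ)}
    (hP : Integrable (fun x => ‖x‖ ^ 2) P) (hQ : Integrable (fun y => ‖y‖ ^ 2) Q)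
    (M : Matrix (Fin I) (Fin J) ℝ) :
    BddAbove ((fun π' => (M.transpose * crossCov π').trace) '' couplings P Q) := by
  refine ⟨∑ j, ∑ i, |M i j| * ((∫ x, ‖x‖ ^ 2 ∂P) + ∫ y, ‖y‖ ^ 2 ∂Q), ?_⟩
  rintro _ ⟨π, hπ, rfl⟩
  simp only [Matrix.trace, Matrix.diag, Matrix.mul_apply, Matrix.transpose_apply, crossCov, Matrix.of_apply]
  refine Finset.sum_le_sum fun j _ => Finset.sum_le_sum fun i _ => ?_
  refine (le_abs_self _).trans ?_
  rw [abs_mul, ← (bound_int hP hQ hπ).2]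
  refine mul_le_mul_of_nonneg_left ?_ (abs_nonneg _)
  exact norm_integral_le_of_norm_le (f := fun p => p.1 i * p.2 j) (bound_int hP hQ hπ).1 (.of_forall fun p => entry_bound p i j)

lemma opt_iff {I J : ℕ} {P : Measure (Fin I → ℝ)} {Q : Measure (Fin J → ℝ)}
    (hP : Integrable (fun x => ‖x‖ ^ 2) P) (hQ : Integrable (fun y => ‖y‖ ^ 2) Q)
    {π : Measure ((Fin I → ℝ) × (Fin J → ℝ))} (hπ : π ∈ couplings P Q)
    (M : Matrix (Fin I) (Fin J) ℝ) :
    ((M.transpose * crossCov π).trace =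
        sSup ((fun π' => (M.transpose * crossCov π').trace) '' couplings P Q)) ↔
    ∀ π' ∈ couplings P Q, ∫ p, cst M p ∂π' ≤ ∫ p, cst M p ∂π := by
  constructor
  · intro h π' hπ'
    rw [← trace_eq hP hQ hπ, ← trace_eq hP hQ hπ', h]
    exact le_csSup (bdd hP hQ M) ⟨π', hπ', rfl⟩
  · intro h
    symm
    apply IsGreatest.csSup_eq
    refine ⟨⟨π, hπ, rfl⟩, ?_⟩
    rintro _ ⟨π', hπ', rfl⟩
    simp only
    rw [trace_eq hP hQ hπ, trace_eq hP hQ hπ']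
    exact h π' hπ'

/-- Rockafellar's construction. -/
noncomputable def chainVal {I J : ℕ} (M : Matrix (Fin I) (Fin J) ℝ)
    (q : ℕ × (ℕ → (Fin I → ℝ) × (Fin J → ℝ))) (z : Fin I → ℝ) : ℝ :=
  M.mulVec (q.2 q.1).2 ⬝ᵥ (z - (q.2 q.1).1) +
    ∑ k ∈ Finset.range q.1, M.mulVec (q.2 k).2 ⬝ᵥ ((q.2 (k+1)).1 - (q.2 k).1)

lemma rockafellar {I J : ℕ} (M : Matrix (Fin I) (Fin J) ℝ)
    (S : Set ((Fin I → ℝ) × (Fin J → ℝ))) (hS : S.Nonempty)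
    (hcyc : ∀ (n : ℕ) (p : Fin (n + 1) → (Fin I → ℝ) × (Fin J → ℝ)), (∀ k, p k ∈ S) →
      ∑ k, cst M ((p (k + 1)).1, (p k).2) ≤ ∑ k, cst M (p k)) :
    ∃ u : (Fin I → ℝ) → EReal,
        (∃ x, u x ≠ ⊤) ∧ (∀ x, u x ≠ ⊥) ∧ LowerSemicontinuous u ∧ ERealConvexOn u ∧
          ∀ p ∈ S, ∀ z : Fin I → ℝ,
            u p.1 + ((M.mulVec p.2 ⬝ᵥ (z - p.1) : ℝ) : EReal) ≤ u z := by
  obtain ⟨p0, hp0⟩ := hS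
  let T := {q : ℕ × (ℕ → (Fin I → ℝ) × (Fin J → ℝ)) // q.2 0 = p0 ∧ ∀ k, q.2 k ∈ S}
  let u : (Fin I → ℝ) → EReal := fun z => ⨆ q : T, (chainVal M q.1 z : EReal)
  have hle : ∀ (q : T) z, (chainVal M q.1 z : EReal) ≤ u z := fun q z =>
    le_iSup (fun q : T => (chainVal M q.1 z : EReal)) q
  refine ⟨u, ⟨p0.1, ?_⟩, ?_, ?_, ?_, ?_⟩
  · have : u p0.1 ≤ (0 : ℝ) := by
      refine iSup_le ?_
      rintro ⟨⟨n, p⟩, h0, hp⟩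
      rw [EReal.coe_le_coe_iff]
      have := hcyc n (fun k => p k) (fun k => hp k)
      rw [Fin.sum_univ_castSucc, Fin.sum_univ_castSucc] at this
      simp only [Fin.coeSucc_eq_succ, Fin.val_succ, Fin.val_castSucc, Fin.last_add_one, Fin.val_last, Fin.val_zero] at this
      rw [Fin.sum_univ_eq_sum_range (fun k => cst M ((p (k+1)).1, (p k).2)) n,
        Fin.sum_univ_eq_sum_range (fun k => cst M (p k)) n] at this
      simp only at h0
      simp only [cst, h0] at this
      simp only [chainVal, dotProduct_sub, Finset.sum_sub_distrib]
      linarith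
    exact ne_top_of_le_ne_top (EReal.coe_ne_top _) this
  · intro x hx
    have := hle ⟨(0, fun _ => p0), rfl, fun _ => hp0⟩ x
    rw [hx, le_bot_iff] at this
    exact EReal.coe_ne_bot _ this
  · refine lowerSemicontinuous_iSup fun q => Continuous.lowerSemicontinuous ?_
    refine continuous_coe_real_ereal.comp ?_
    unfold chainVal
    fun_prop
  · intro x y a b ha hb hab
    refine iSup_le fun q => ?_
    have : chainVal M q.1 (a • x + b • y) = a * chainVal M q.1 x + b * chainVal M q.1 y := by
      simp only [chainVal, dotProduct_sub, dotProduct_add, dotProduct_smul, smul_eq_mul]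
      have : b = 1 - a := by linarith
      subst this
      ring
    rw [this, EReal.coe_add, EReal.coe_mul, EReal.coe_mul]
    exact add_le_add (mul_le_mul_of_nonneg_left (hle q x) (EReal.coe_nonneg.2 ha))
      (mul_le_mul_of_nonneg_left (hle q y) (EReal.coe_nonneg.2 hb))
  · intro p hp z
    rw [← EReal.le_sub_iff_add_le (Or.inl (EReal.coe_ne_bot _)) (Or.inl (EReal.coe_ne_top _))]
    refine iSup_le ?_
    rintro ⟨⟨n, q⟩, h0, hq⟩
    rw [EReal.le_sub_iff_add_le (Or.inl (EReal.coe_ne_bot _)) (Or.inl (EReal.coe_ne_top _)), ← EReal.coe_add]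
    refine le_trans (le_of_eq ?_) (hle ⟨(n + 1, fun k => if k ≤ n then q k else p), ?_, ?_⟩ z)
    · congr 1
      simp only [chainVal, Finset.sum_range_succ]
      have hs : ∑ k ∈ Finset.range n, M.mulVec (if k ≤ n then q k else p).2 ⬝ᵥ
          ((if k + 1 ≤ n then q (k + 1) else p).1 - (if k ≤ n then q k else p).1) =
          ∑ k ∈ Finset.range n, M.mulVec (q k).2 ⬝ᵥ ((q (k+1)).1 - (q k).1) := by
        refine Finset.sum_congr rfl fun k hk => ?_
        have := Finset.mem_range.1 hk
        rw [if_pos (by omega), if_pos (by omega)]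
      rw [hs]
      simp only [le_refl, if_true, Nat.not_succ_le_self, if_false]
      ring
    · simpa using h0
    · intro k
      dsimp only
      split_ifs
      exacts [hq k, hp]

lemma coord_int {I J : ℕ} {P : Measure (Fin I → ℝ)} {Q : Measure (Fin J → ℝ)}
    (hP : Integrable (fun x => ‖x‖ ^ 2) P) (hQ : Integrable (fun y => ‖y‖ ^ 2) Q)
    {π : Measure ((Fin I → ℝ) × (Fin J → ℝ))} (hπ : π ∈ couplings P Q) :
    (∀ i, Integrable (fun p => p.1 i) π) ∧ (∀ j, Integrable (fun p => p.2 j) π) := by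
  have hb := (bound_int hP hQ hπ).1
  have := hπ.1
  constructor
  · intro i
    refine ((integrable_const (1 : ℝ)).add hb).mono'
      (by fun_prop : Continuous fun p : (Fin I → ℝ) × (Fin J → ℝ) => p.1 i).aestronglyMeasurable
      (.of_forall fun p => ?_)
    have h1 : ‖p.1 i‖ ≤ ‖p.1‖ := norm_le_pi_norm p.1 i
    simp only [Pi.add_apply]
    nlinarith [sq_nonneg (‖p.1‖ - 1), sq_nonneg (‖p.1‖), sq_nonneg ‖p.2‖]
  · intro i
    refine ((integrable_const (1 : ℝ)).add hb).mono'
      (by fun_prop : Continuous fun p : (Fin I → ℝ) × (Fin J → ℝ) => p.2 i).aestronglyMeasurable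
      (.of_forall fun p => ?_)
    have h1 : ‖p.2 i‖ ≤ ‖p.2‖ := norm_le_pi_norm p.2 i
    simp only [Pi.add_apply]
    nlinarith [sq_nonneg (‖p.2‖ - 1), sq_nonneg (‖p.1‖), sq_nonneg ‖p.2‖]

lemma duality {I J : ℕ} {P : Measure (Fin I → ℝ)} {Q : Measure (Fin J → ℝ)}
    (hP : Integrable (fun x => ‖x‖ ^ 2) P) (hQ : Integrable (fun y => ‖y‖ ^ 2) Q)
    {π : Measure ((Fin I → ℝ) × (Fin J → ℝ))} (hπ : π ∈ couplings P Q)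
    (M : Matrix (Fin I) (Fin J) ℝ) (u : (Fin I → ℝ) → EReal)
    (hu1 : ∃ x, u x ≠ ⊤) (hu2 : ∀ x, u x ≠ ⊥) (hu3 : LowerSemicontinuous u)
    (hu : ∀ᵐ p ∂π, ∀ z : Fin I → ℝ, u p.1 + ((M.mulVec p.2 ⬝ᵥ (z - p.1) : ℝ) : EReal) ≤ u z)
    {π' : Measure ((Fin I → ℝ) × (Fin J → ℝ))} (hπ' : π' ∈ couplings P Q) :
    ∫ p, cst M p ∂π' ≤ ∫ p, cst M p ∂π := by
  have hc := cst_int hP hQ hπ M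
  have hc' := cst_int hP hQ hπ' M
  have hPm : ∀ w : Fin I → ℝ, ∀ a : ℝ, Integrable (fun p => w ⬝ᵥ p.1 + a) π := by
    have := hπ.1
    intro w a
    refine Integrable.add ?_ (integrable_const a)
    simp only [dotProduct]
    exact integrable_finsetSum _ fun i _ => (coord_int hP hQ hπ).1 i |>.const_mul _
  have hQm : ∀ w : Fin I → ℝ, ∀ a : ℝ, Integrable (fun p => M.mulVec p.2 ⬝ᵥ w + a) π := by
    have := hπ.1
    intro w a
    refine Integrable.add ?_ (integrable_const a)
    simp only [dotProduct, Matrix.mulVec]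
    exact integrable_finsetSum _ fun i _ => (integrable_finsetSum _ fun j _ =>
      ((coord_int hP hQ hπ).2 j).const_mul _).mul_const _
  obtain ⟨_, hf, hs⟩ := hπ
  obtain ⟨_, hf', hs'⟩ := hπ'
  obtain ⟨z1, hz1⟩ := hu1
  have hco : ∀ z, u z ≠ ⊤ → u z = ((u z).toReal : EReal) := fun z hz =>
    (EReal.coe_toReal hz (hu2 z)).symm
  have hgood : ∀ᵐ p ∂π, u p.1 ≠ ⊤ ∧ ∀ z, u z ≠ ⊤ →
      (u p.1).toReal + M.mulVec p.2 ⬝ᵥ (z - p.1) ≤ (u z).toReal := by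
    filter_upwards [hu] with p hp
    have h1 : u p.1 ≠ ⊤ := by
      intro h
      have := hp z1
      rw [h, EReal.top_add_coe, top_le_iff] at this
      exact hz1 this
    refine ⟨h1, fun z hz => ?_⟩
    have := hp z
    rw [hco _ h1, hco _ hz, ← EReal.coe_add, EReal.coe_le_coe_iff] at this
    simpa using this
  let v : (Fin J → ℝ) → EReal := fun y =>
    ⨆ z : {z // u z ≠ ⊤}, ((M.mulVec y ⬝ᵥ z.1 - (u z.1).toReal : ℝ) : EReal)
  have hvle : ∀ y z, u z ≠ ⊤ → ((M.mulVec y ⬝ᵥ z - (u z).toReal : ℝ) : EReal) ≤ v y :=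
    fun y z hz => le_iSup (fun z : {z // u z ≠ ⊤} =>
      ((M.mulVec y ⬝ᵥ z.1 - (u z.1).toReal : ℝ) : EReal)) ⟨z, hz⟩
  have hvbot : ∀ y, v y ≠ ⊥ := fun y h => by
    have := hvle y z1 hz1
    rw [h, le_bot_iff] at this
    exact EReal.coe_ne_bot _ this
  have hvm : Measurable v := by
    refine LowerSemicontinuous.measurable (lowerSemicontinuous_iSup fun z =>
      Continuous.lowerSemicontinuous (continuous_coe_real_ereal.comp ?_))
    fun_prop
  have hum : Measurable u := hu3.measurable
  have hv : ∀ᵐ p ∂π, v p.2 = ((cst M p - (u p.1).toReal : ℝ) : EReal) := by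
    filter_upwards [hgood] with p hp
    refine le_antisymm (iSup_le fun z => ?_) (hvle p.2 p.1 hp.1)
    rw [EReal.coe_le_coe_iff]
    have := hp.2 z.1 z.2
    rw [dotProduct_sub] at this
    unfold cst
    linarith
  -- finiteness passes to the marginals
  have hPfin : ∀ᵐ x ∂P, u x ≠ ⊤ := by
    rw [← hf]
    refine (ae_map_iff measurable_fst.aemeasurable (hum (measurableSet_singleton _).compl)).2 ?_
    exact hgood.mono fun p hp => hp.1
  have hQfin : ∀ᵐ y ∂Q, v y ≠ ⊤ := by
    rw [← hs]
    refine (ae_map_iff measurable_snd.aemeasurable (hvm (measurableSet_singleton _).compl)).2 ?_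
    refine hv.mono fun p hp => ?_
    change v p.2 ≠ ⊤
    rw [hp]
    exact EReal.coe_ne_top _
  have hle' : ∀ᵐ p ∂π', cst M p ≤ (u p.1).toReal + (v p.2).toReal := by
    rw [← hf'] at hPfin
    rw [← hs'] at hQfin
    filter_upwards [ae_of_ae_map measurable_fst.aemeasurable hPfin,
      ae_of_ae_map measurable_snd.aemeasurable hQfin] with p h1 h2
    have := hvle p.2 p.1 h1
    rw [← EReal.coe_toReal h2 (hvbot _), EReal.coe_le_coe_iff] at this
    unfold cst
    linarith
  have heq : ∀ᵐ p ∂π, cst M p = (u p.1).toReal + (v p.2).toReal := by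
    filter_upwards [hv] with p hp
    rw [hp, EReal.toReal_coe]
    ring
  have hurm : Measurable fun x => (u x).toReal := hum.ereal_toReal
  have hvrm : Measurable fun y => (v y).toReal := hvm.ereal_toReal
  have hui : Integrable (fun p => (u p.1).toReal) π := by
    obtain ⟨p0, hp0⟩ := hgood.exists
    have hl := hPm (M.mulVec p0.2) ((u p0.1).toReal - M.mulVec p0.2 ⬝ᵥ p0.1)
    have hr := hc.sub (hQm p0.1 (-(u p0.1).toReal))
    refine (hl.abs.add hr.abs).mono' (hurm.comp measurable_fst).aestronglyMeasurable ?_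
    filter_upwards [hgood, hv] with p hp hvp
    have h1 := hp0.2 p.1 hp.1
    have h2 := hvle p.2 p0.1 hp0.1
    rw [hvp, EReal.coe_le_coe_iff] at h2
    rw [dotProduct_sub] at h1
    simp only [Pi.add_apply, Pi.sub_apply, Real.norm_eq_abs]
    rw [abs_le]
    constructor
    · have a1 := neg_abs_le (M.mulVec p0.2 ⬝ᵥ p.1 + ((u p0.1).toReal - M.mulVec p0.2 ⬝ᵥ p0.1))
      have a2 := abs_nonneg (cst M p - (M.mulVec p.2 ⬝ᵥ p0.1 + -(u p0.1).toReal))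
      linarith
    · have a1 := abs_nonneg (M.mulVec p0.2 ⬝ᵥ p.1 + ((u p0.1).toReal - M.mulVec p0.2 ⬝ᵥ p0.1))
      have a2 := le_abs_self (cst M p - (M.mulVec p.2 ⬝ᵥ p0.1 + -(u p0.1).toReal))
      linarith
  have hvi : Integrable (fun p => (v p.2).toReal) π := by
    refine (hc.sub hui).congr ?_
    filter_upwards [heq] with p hp
    simp only [Pi.sub_apply]
    linarith
  have huP : Integrable (fun x => (u x).toReal) P := by
    rw [← hf]
    exact (integrable_map_measure hurm.aestronglyMeasurable measurable_fst.aemeasurable).2 hui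
  have hvQ : Integrable (fun y => (v y).toReal) Q := by
    rw [← hs]
    exact (integrable_map_measure hvrm.aestronglyMeasurable measurable_snd.aemeasurable).2 hvi
  have e1 : ∫ p, cst M p ∂π = (∫ x, (u x).toReal ∂P) + ∫ y, (v y).toReal ∂Q := by
    rw [integral_congr_ae heq, integral_add hui hvi, ← hf, ← hs,
      integral_map measurable_fst.aemeasurable hurm.aestronglyMeasurable,
      integral_map measurable_snd.aemeasurable hvrm.aestronglyMeasurable]
  have hui' : Integrable (fun p => (u p.1).toReal) π' := by
    rw [← hf'] at huP
    exact huP.comp_measurable measurable_fst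
  have hvi' : Integrable (fun p => (v p.2).toReal) π' := by
    rw [← hs'] at hvQ
    exact hvQ.comp_measurable measurable_snd
  have e2 : ∫ p, ((u p.1).toReal + (v p.2).toReal) ∂π' =
      (∫ x, (u x).toReal ∂P) + ∫ y, (v y).toReal ∂Q := by
    rw [integral_add hui' hvi', ← hf', ← hs',
      integral_map measurable_fst.aemeasurable hurm.aestronglyMeasurable,
      integral_map measurable_snd.aemeasurable hvrm.aestronglyMeasurable]
  rw [e1, ← e2]
  exact integral_mono_ae hc' (hui'.add hvi') hle'

lemma map_finsum_measure {α β ι : Type*} [MeasurableSpace α] [MeasurableSpace β] [Fintype ι]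
    (f : α → β) (hf : Measurable f) (μ : ι → Measure α) :
    (∑ k, μ k).map f = ∑ k, (μ k).map f := by
  ext s hs
  simp [Measure.map_apply hf hs]

lemma cyclic {I J : ℕ} {P : Measure (Fin I → ℝ)} {Q : Measure (Fin J → ℝ)}
    [IsProbabilityMeasure P]
    (hP : Integrable (fun x => ‖x‖ ^ 2) P) (hQ : Integrable (fun y => ‖y‖ ^ 2) Q)
    {π : Measure ((Fin I → ℝ) × (Fin J → ℝ))} (hπ : π ∈ couplings P Q)
    (M : Matrix (Fin I) (Fin J) ℝ)
    (hopt : ∀ π' ∈ couplings P Q, ∫ p, cst M p ∂π' ≤ ∫ p, cst M p ∂π)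
    (n : ℕ) (p : Fin (n + 1) → (Fin I → ℝ) × (Fin J → ℝ)) (hp : ∀ k, p k ∈ π.support) :
    ∑ k, cst M ((p (k + 1)).1, (p k).2) ≤ ∑ k, cst M (p k) := by
  by_contra! hlt
  have := hπ.1
  obtain ⟨δ, hδ, hgap⟩ : ∃ δ : ℝ, 0 < δ ∧
      ∑ k, (cst M (p k) + δ) < ∑ k, (cst M ((p (k + 1)).1, (p k).2) - δ) := by
    refine ⟨(∑ k, cst M ((p (k + 1)).1, (p k).2) - ∑ k, cst M (p k)) / (4 * (n + 1)),
      div_pos (by linarith) (by positivity), ?_⟩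
    simp only [Finset.sum_add_distrib, Finset.sum_sub_distrib, Finset.sum_const, Finset.card_univ,
      Fintype.card_fin, nsmul_eq_mul]
    set A := ∑ k, cst M ((p (k + 1)).1, (p k).2)
    set B := ∑ k, cst M (p k)
    have : ((n + 1 : ℕ) : ℝ) * ((A - B) / (4 * (n + 1))) = (A - B) / 4 := by
      push_cast
      field_simp
    rw [this]
    linarith
  have hloc : ∀ q : (Fin I → ℝ) × (Fin J → ℝ), ∀ᶠ r in 𝓝[>] (0 : ℝ),
      ∀ x ∈ Metric.ball q.1 r, ∀ y ∈ Metric.ball q.2 r, |cst M (x, y) - cst M q| < δ := by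
    intro q
    obtain ⟨ε, hε, h⟩ := Metric.continuousAt_iff.1 ((cst_cont M).continuousAt (x := q)) δ hδ
    filter_upwards [Ioo_mem_nhdsGT hε] with r hr x hx y hy
    refine h (x := (x, y)) ?_
    rw [Prod.dist_eq]
    exact max_lt (lt_trans hx hr.2) (lt_trans hy hr.2)
  obtain ⟨r, ⟨h1, h2⟩, hr⟩ := (((Filter.eventually_all.2 fun k => hloc (p k)).and
    (Filter.eventually_all.2 fun k => hloc ((p (k + 1)).1, (p k).2))).and
      self_mem_nhdsWithin).exists
  have hr : 0 < r := hr
  let U : Fin (n + 1) → Set (Fin I → ℝ) := fun k => Metric.ball (p k).1 r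
  let V : Fin (n + 1) → Set (Fin J → ℝ) := fun k => Metric.ball (p k).2 r
  let A : Fin (n + 1) → Set ((Fin I → ℝ) × (Fin J → ℝ)) := fun k => U k ×ˢ V k
  have hAm : ∀ k, MeasurableSet (A k) := fun k =>
    Metric.isOpen_ball.measurableSet.prod Metric.isOpen_ball.measurableSet
  have hpos : ∀ k, 0 < π (A k) := fun k =>
    (Measure.mem_support_iff_forall (p k)).1 (hp k) _
      (prod_mem_nhds (Metric.ball_mem_nhds _ hr) (Metric.ball_mem_nhds _ hr))
  let μ : Fin (n + 1) → Measure ((Fin I → ℝ) × (Fin J → ℝ)) := fun k =>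
    ProbabilityTheory.cond π (A k)
  have hμp : ∀ k, IsProbabilityMeasure (μ k) := fun k =>
    ProbabilityTheory.cond_isProbabilityMeasure (hpos k).ne'
  have hμA : ∀ k, ∀ᵐ q ∂(μ k), q ∈ A k := fun k => ProbabilityTheory.ae_cond_mem (hAm k)
  have hμ1 : ∀ k, IsProbabilityMeasure ((μ k).map Prod.fst) := fun k =>
    Measure.isProbabilityMeasure_map measurable_fst.aemeasurable
  have hμ2 : ∀ k, IsProbabilityMeasure ((μ k).map Prod.snd) := fun k =>
    Measure.isProbabilityMeasure_map measurable_snd.aemeasurable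
  obtain ⟨k0, hk0⟩ := Finite.exists_min fun k => π (A k)
  let t : ENNReal := π (A k0) / (n + 1 : ℕ)
  have ht0 : t ≠ 0 := (ENNReal.div_pos (hpos k0).ne' (ENNReal.natCast_ne_top _)).ne'
  have htt : t ≠ ⊤ := ENNReal.div_ne_top (measure_ne_top _ _) (by simp)
  let ν : Measure ((Fin I → ℝ) × (Fin J → ℝ)) := ∑ k, t • μ k
  let τ : Fin (n + 1) → Measure ((Fin I → ℝ) × (Fin J → ℝ)) := fun k =>
    ((μ (k + 1)).map Prod.fst).prod ((μ k).map Prod.snd)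
  let ρ : Measure ((Fin I → ℝ) × (Fin J → ℝ)) := ∑ k, t • τ k
  have hνle : ν ≤ π := by
    refine Measure.le_iff.2 fun s hs => ?_
    have hk : ∀ k, (t • μ k) s ≤ π s / (n + 1 : ℕ) := by
      intro k
      simp only [Measure.smul_apply, smul_eq_mul, μ, ProbabilityTheory.cond_apply (hAm k), t]
      calc π (A k0) / (n + 1 : ℕ) * ((π (A k))⁻¹ * π (A k ∩ s))
          ≤ π (A k) / (n + 1 : ℕ) * ((π (A k))⁻¹ * π s) := by
            exact mul_le_mul' (ENNReal.div_le_div_right (hk0 k) _)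
              (mul_le_mul' le_rfl (measure_mono Set.inter_subset_right))
        _ = (π (A k) * (π (A k))⁻¹) * (π s / (n + 1 : ℕ)) := by
            simp only [div_eq_mul_inv]; ring
        _ = π s / (n + 1 : ℕ) := by
            rw [ENNReal.mul_inv_cancel (hpos k).ne' (measure_ne_top _ _), one_mul]
    calc ν s = ∑ k, (t • μ k) s := by simp [ν]
      _ ≤ ∑ k : Fin (n + 1), π s / (n + 1 : ℕ) := Finset.sum_le_sum fun k _ => hk k
      _ = π s := by
        rw [Finset.sum_const, Finset.card_univ, Fintype.card_fin, nsmul_eq_mul]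
        exact ENNReal.mul_div_cancel (by simp) (ENNReal.natCast_ne_top _)
  have : IsFiniteMeasure ν := isFiniteMeasure_of_le π hνle
  have hsub : π - ν + ν = π := Measure.sub_add_cancel_of_le hνle
  have hfst : ρ.map Prod.fst = ν.map Prod.fst := by
    simp only [ρ, ν, τ, map_finsum_measure _ measurable_fst, Measure.map_smul,
      Measure.map_fst_prod, measure_univ, one_smul]
    exact Equiv.sum_comp (Equiv.addRight (1 : Fin (n + 1))) fun k => t • (μ k).map Prod.fst
  have hsnd : ρ.map Prod.snd = ν.map Prod.snd := by
    simp only [ρ, ν, τ, map_finsum_measure _ measurable_snd, Measure.map_smul,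
      Measure.map_snd_prod, measure_univ, one_smul]
  have hπ' : π - ν + ρ ∈ couplings P Q := by
    have e1 : (π - ν + ρ).map Prod.fst = P := by
      rw [Measure.map_add _ _ measurable_fst, hfst, ← Measure.map_add _ _ measurable_fst, hsub,
        hπ.2.1]
    have e2 : (π - ν + ρ).map Prod.snd = Q := by
      rw [Measure.map_add _ _ measurable_snd, hsnd, ← Measure.map_add _ _ measurable_snd, hsub,
        hπ.2.2]
    refine ⟨⟨?_⟩, e1, e2⟩
    have := measure_univ (μ := P)
    rwa [← e1, Measure.map_apply measurable_fst MeasurableSet.univ, Set.preimage_univ] at this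
  have hc := cst_int hP hQ hπ M
  have hc' := cst_int hP hQ hπ' M
  have hle := hopt _ hπ'
  rw [← hsub] at hc
  have i0 := hc.left_of_add_measure
  have iν := hc.right_of_add_measure
  have iρ := hc'.right_of_add_measure
  rw [integral_add_measure i0 iρ] at hle
  have hπe : ∫ q, cst M q ∂π = ∫ q, cst M q ∂(π - ν) + ∫ q, cst M q ∂ν := by
    rw [← integral_add_measure i0 iν, hsub]
  rw [hπe] at hle
  have jν := integrable_finsetSum_measure.1 iν
  have jρ := integrable_finsetSum_measure.1 iρ
  have eν : ∫ q, cst M q ∂ν = t.toReal * ∑ k, ∫ q, cst M q ∂(μ k) := by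
    rw [integral_finsetSum_measure jν, Finset.mul_sum]
    simp only [integral_smul_measure, smul_eq_mul]
  have eρ : ∫ q, cst M q ∂ρ = t.toReal * ∑ k, ∫ q, cst M q ∂(τ k) := by
    rw [integral_finsetSum_measure jρ, Finset.mul_sum]
    simp only [integral_smul_measure, smul_eq_mul]
  have bν : ∀ k, ∫ q, cst M q ∂(μ k) ≤ cst M (p k) + δ := by
    intro k
    have hi : Integrable (cst M) (μ k) :=
      (integrable_smul_measure ht0 htt).1 (jν k (Finset.mem_univ _))
    calc ∫ q, cst M q ∂(μ k) ≤ ∫ q, (cst M (p k) + δ) ∂(μ k) := by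
          refine integral_mono_ae hi (integrable_const _) ?_
          filter_upwards [hμA k] with q hq
          have := (abs_lt.1 (h1 k q.1 hq.1 q.2 hq.2)).2
          linarith
      _ = _ := by simp
  have bρ : ∀ k, cst M ((p (k + 1)).1, (p k).2) - δ ≤ ∫ q, cst M q ∂(τ k) := by
    intro k
    have hi : Integrable (cst M) (τ k) :=
      (integrable_smul_measure ht0 htt).1 (jρ k (Finset.mem_univ _))
    have hU : ∀ᵐ x ∂((μ (k + 1)).map Prod.fst), x ∈ U (k + 1) :=
      (ae_map_iff measurable_fst.aemeasurable Metric.isOpen_ball.measurableSet).2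
        ((hμA (k + 1)).mono fun q hq => hq.1)
    have hV : ∀ᵐ x ∂((μ k).map Prod.snd), x ∈ V k :=
      (ae_map_iff measurable_snd.aemeasurable Metric.isOpen_ball.measurableSet).2
        ((hμA k).mono fun q hq => hq.2)
    calc cst M ((p (k + 1)).1, (p k).2) - δ
        = ∫ q, (cst M ((p (k + 1)).1, (p k).2) - δ) ∂(τ k) := by simp [τ]
      _ ≤ ∫ q, cst M q ∂(τ k) := by
          refine integral_mono_ae (integrable_const _) hi ?_
          filter_upwards [Measure.quasiMeasurePreserving_fst.ae hU,
            Measure.quasiMeasurePreserving_snd.ae hV] with q hq1 hq2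
          have := (abs_lt.1 (h2 k q.1 hq1 q.2 hq2)).1
          linarith
  have s1 := Finset.sum_le_sum fun k (_ : k ∈ Finset.univ) => bν k
  have s2 := Finset.sum_le_sum fun k (_ : k ∈ Finset.univ) => bρ k
  have htpos : 0 < t.toReal := ENNReal.toReal_pos ht0 htt
  have := mul_lt_mul_of_pos_left (lt_of_le_of_lt s1 (lt_of_lt_of_le hgap s2)) htpos
  rw [eν, eρ] at hle
  linarith

theorem maxCorrelation_iff_subdifferential {I J : ℕ} (hI : 0 < I) (hJ : 0 < J)
    (P : Measure (Fin I → ℝ)) (Q : Measure (Fin J → ℝ))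
    [IsProbabilityMeasure P] [IsProbabilityMeasure Q]
    (hP : Integrable (fun x => ‖x‖ ^ 2) P) (hQ : Integrable (fun y => ‖y‖ ^ 2) Q)
    (π : Measure ((Fin I → ℝ) × (Fin J → ℝ))) (hπ : π ∈ couplings P Q)
    (M : Matrix (Fin I) (Fin J) ℝ) (hM : M ≠ 0) :
    ((M.transpose * crossCov π).trace =
        sSup ((fun π' => (M.transpose * crossCov π').trace) '' couplings P Q)) ↔
      ∃ u : (Fin I → ℝ) → EReal,
        (∃ x, u x ≠ ⊤) ∧ (∀ x, u x ≠ ⊥) ∧ LowerSemicontinuous u ∧ ERealConvexOn u ∧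
          ∀ᵐ p ∂π, ∀ z : Fin I → ℝ,
            u p.1 + ((M.mulVec p.2 ⬝ᵥ (z - p.1) : ℝ) : EReal) ≤ u z := by
  rw [opt_iff hP hQ hπ M]
  constructor
  · intro h
    have := hπ.1
    obtain ⟨u, h1, h2, h3, h4, h5⟩ := rockafellar M π.support
      (Measure.nonempty_support (IsProbabilityMeasure.ne_zero π))
      (fun n p hp => cyclic hP hQ hπ M h n p hp)
    refine ⟨u, h1, h2, h3, h4, ?_⟩
    filter_upwards [Measure.support_mem_ae] with p hp
    exact h5 p hp
  · rintro ⟨u, h1, h2, h3, h4, h5⟩ π' hπ'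
    exact duality hP hQ hπ M u h1 h2 h3 h5 hπ'
end
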